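/- arXiv:2407.11778 — 4 statements merged into one kernel-verified Lean document; each statement's English description precedes it below -/
import Mathlib

section
/- Functional characterization of no leakage: a feature selector ζ has no leakage if and only if the probability of each mask depends only on the values of the features selected by that mask; precisely, ζ has no leakage if and only if for every mask h and all x, x' with p(x) > 0, p(x') > 0 and x⊙h = x'⊙h, it holds that ζ(h|x) = ζ(h|x'). -/
open Finset

noncomputable section

/-- A feature mask over `d` features: `true` means the feature is selected. -/
abbrev Mask (d : ℕ) := Fin d → Bool

variable {d : ℕ} {V : Fin d → Type*} {Y : Type*}

/-- The masked feature vector `x ⊙ h`: selected features keep their value,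
non-selected features are replaced by the masking symbol `none` (∅). -/
def applyMask (x : ∀ i, V i) (h : Mask d) : ∀ i, Option (V i) :=
  fun i => if h i then some (x i) else none

/-- The number of selected features `‖h‖₀`, as a real number. -/
def maskSize {d : ℕ} (h : Mask d) : ℝ :=
  ((Finset.univ.filter fun i => h i = true).card : ℝ)

section Leakage

variable [∀ i, Fintype (V i)] [∀ i, DecidableEq (V i)] [∀ i, Nonempty (V i)]
  [Fintype Y] [DecidableEq Y]

variable (p : (∀ i, V i) → Y → ℝ) (ζ : (∀ i, V i) → Mask d → ℝ)

/-- Marginal probability `p(x)`. -/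
def pX (x : ∀ i, V i) : ℝ := ∑ y, p x y

/-- `p` is a probability distribution on `X × Y`. -/
def IsDist : Prop := (∀ x y, 0 ≤ p x y) ∧ (∑ x, ∑ y, p x y) = 1

/-- `ζ` is a feature selector: for every `x` with `p(x) > 0`, `ζ(·|x)` is a
probability distribution over masks. -/
def IsSelector : Prop :=
  (∀ x h, 0 ≤ ζ x h) ∧ ∀ x, 0 < pX p x → (∑ h : Mask d, ζ x h) = 1

/-- `p(x[s^in])`: probability that the features selected by `h` take the values `x[s^in]`. -/
def pIn (h : Mask d) (x : ∀ i, V i) : ℝ :=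
  ∑ x' ∈ univ.filter (fun x' => applyMask x' h = applyMask x h), pX p x'

/-- `p(x[s^in], y)`. -/
def pInY (h : Mask d) (x : ∀ i, V i) (y : Y) : ℝ :=
  ∑ x' ∈ univ.filter (fun x' => applyMask x' h = applyMask x h), p x' y

/-- `p(x[s^in], h[s^in]=1, h[s^ex]=0)` under the joint distribution `p(x,y)·ζ(h|x)`. -/
def pInSel (h : Mask d) (x : ∀ i, V i) : ℝ :=
  ∑ x' ∈ univ.filter (fun x' => applyMask x' h = applyMask x h), pX p x' * ζ x' h

/-- `p(x[s^in], y, h[s^in]=1, h[s^ex]=0)`. -/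
def pInYSel (h : Mask d) (x : ∀ i, V i) (y : Y) : ℝ :=
  ∑ x' ∈ univ.filter (fun x' => applyMask x' h = applyMask x h), p x' y * ζ x' h

/-- `p(y | x[s^in])`. -/
def condLabel (h : Mask d) (x : ∀ i, V i) (y : Y) : ℝ := pInY p h x y / pIn p h x

/-- `p(y | x[s^in], h[s^in]=1, h[s^ex]=0)`. -/
def condLabelSel (h : Mask d) (x : ∀ i, V i) (y : Y) : ℝ :=
  pInYSel p ζ h x y / pInSel p ζ h x

/-- `p(x[s^ex] | x[s^in])`. -/
def condFeat (h : Mask d) (x : ∀ i, V i) : ℝ := pX p x / pIn p h x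

/-- `p(x[s^ex] | x[s^in], h[s^in]=1, h[s^ex]=0)`. -/
def condFeatSel (h : Mask d) (x : ∀ i, V i) : ℝ :=
  (pX p x * ζ x h) / pInSel p ζ h x

/-- `p(h[s^in]=1, h[s^ex]=0 | x[s^in])`. -/
def condSel (h : Mask d) (x : ∀ i, V i) : ℝ := pInSel p ζ h x / pIn p h x

/-- `p(h[s^in]=1, h[s^ex]=0 | x[s^in], y)`. -/
def condSelY (h : Mask d) (x : ∀ i, V i) (y : Y) : ℝ :=
  pInYSel p ζ h x y / pInY p h x y

/-- `p(h[s^in]=1, h[s^ex]=0 | x[s^in], x[s^ex])`. -/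
def condSelX (h : Mask d) (x : ∀ i, V i) : ℝ := (pX p x * ζ x h) / pX p x

/-- `p(h[s^in]=1, h[s^ex]=0 | x[s^in], x[s^ex], y)`. -/
def condSelXY (h : Mask d) (x : ∀ i, V i) (y : Y) : ℝ := (p x y * ζ x h) / (p x y)

/-- `(x, y, s^in, s^ex) ∈ Ω`, where `s^in`/`s^ex` are the sets of features
selected/not selected by the mask `h`. -/
def InOmega (h : Mask d) (x : ∀ i, V i) (y : Y) : Prop :=
  0 < pX p x ∧ 0 < ζ x h ∧ 0 < pInY p h x y

/-- `ζ` has no label leakage: conditioning the label distribution on the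
selection of features by `ζ` does not change the label distribution. -/
def NoLabelLeakage : Prop :=
  ∀ (h : Mask d) (x : ∀ i, V i) (y : Y), InOmega p ζ h x y →
    condLabel p h x y = condLabelSel p ζ h x y

/-- `ζ` has no feature leakage: conditioning the feature distribution on the
selection of features by `ζ` does not change the feature distribution. -/
def NoFeatureLeakage : Prop :=
  ∀ (h : Mask d) (x : ∀ i, V i) (y : Y), InOmega p ζ h x y →
    condFeat p h x = condFeatSel p ζ h x

section

variable {p ζ}

omit [∀ i, Nonempty (V i)] [DecidableEq Y]

omit [∀ i, DecidableEq (V i)] in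
theorem IsDist.le_pX (hp : IsDist p) (x : ∀ i, V i) (y : Y) : p x y ≤ pX p x :=
  Finset.single_le_sum (f := p x) (fun y _ => hp.1 x y) (mem_univ y)

omit [∀ i, DecidableEq (V i)] in
theorem IsDist.pX_nonneg (hp : IsDist p) (x : ∀ i, V i) : 0 ≤ pX p x :=
  Finset.sum_nonneg fun y _ => hp.1 x y

omit [∀ i, DecidableEq (V i)] in
theorem IsDist.exists_pos (hp : IsDist p) {x : ∀ i, V i} (hx : 0 < pX p x) : ∃ y, 0 < p x y := by
  obtain ⟨y, -, hy⟩ := (Finset.sum_pos_iff_of_nonneg fun y _ => hp.1 x y).1 hx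
  exact ⟨y, hy⟩

theorem IsDist.pIn_pos (hp : IsDist p) (h : Mask d) {x : ∀ i, V i} (hx : 0 < pX p x) :
    0 < pIn p h x :=
  (Finset.sum_pos_iff_of_nonneg fun x' _ => hp.pX_nonneg x').2 ⟨x, by simp, hx⟩

theorem IsDist.pInY_pos (hp : IsDist p) (h : Mask d) {x : ∀ i, V i} {y : Y} (hxy : 0 < p x y) :
    0 < pInY p h x y :=
  (Finset.sum_pos_iff_of_nonneg fun x' _ => hp.1 x' y).2 ⟨x, by simp, hxy⟩

theorem pIn_congr {h : Mask d} {x x' : ∀ i, V i} (hxx' : applyMask x h = applyMask x' h) :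
    pIn p h x = pIn p h x' := by
  simp only [pIn, hxx']

theorem pInSel_congr {h : Mask d} {x x' : ∀ i, V i} (hxx' : applyMask x h = applyMask x' h) :
    pInSel p ζ h x = pInSel p ζ h x' := by
  simp only [pInSel, hxx']

theorem condSel_congr {h : Mask d} {x x' : ∀ i, V i} (hxx' : applyMask x h = applyMask x' h) :
    condSel p ζ h x = condSel p ζ h x' := by
  rw [condSel, condSel, pIn_congr hxx', pInSel_congr hxx']

theorem IsDist.condSel_nonneg (hp : IsDist p) (hζ : ∀ x h, 0 ≤ ζ x h) (h : Mask d)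
    (x : ∀ i, V i) : 0 ≤ condSel p ζ h x :=
  div_nonneg (Finset.sum_nonneg fun x' _ => mul_nonneg (hp.pX_nonneg x') (hζ x' h))
    (Finset.sum_nonneg fun x' _ => hp.pX_nonneg x')

theorem NoFeatureLeakage.eq_condSel_of_pos (hF : NoFeatureLeakage p ζ) (hp : IsDist p)
    (hζ : ∀ x h, 0 ≤ ζ x h) {h : Mask d} {x : ∀ i, V i} (hx : 0 < pX p x) (hxh : 0 < ζ x h) :
    ζ x h = condSel p ζ h x := by
  obtain ⟨y, hy⟩ := hp.exists_pos hx
  have key := hF h x y ⟨hx, hxh, hp.pInY_pos h hy⟩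
  have hIn := hp.pIn_pos h hx
  have hSel : 0 < pInSel p ζ h x :=
    (Finset.sum_pos_iff_of_nonneg fun x' _ => mul_nonneg (hp.pX_nonneg x') (hζ x' h)).2
      ⟨x, by simp, mul_pos hx hxh⟩
  rw [condFeat, condFeatSel, div_eq_div_iff hIn.ne' hSel.ne'] at key
  rw [condSel, eq_div_iff hIn.ne']
  apply mul_left_cancel₀ hx.ne'
  linarith

/-- Without feature leakage, `ζ(h|x)` never exceeds its average over the inputs agreeing with `x`
on the selected features, hence equals that average. -/
theorem NoFeatureLeakage.eq_condSel (hF : NoFeatureLeakage p ζ) (hp : IsDist p)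
    (hζ : ∀ x h, 0 ≤ ζ x h) (h : Mask d) {x : ∀ i, V i} (hx : 0 < pX p x) :
    ζ x h = condSel p ζ h x := by
  have hnonneg : ∀ x' ∈ univ.filter (fun x' => applyMask x' h = applyMask x h),
      0 ≤ pX p x' * (condSel p ζ h x - ζ x' h) := by
    intro x' hx'
    rw [← condSel_congr (mem_filter.1 hx').2]
    rcases (hp.pX_nonneg x').eq_or_lt with h0 | hpos
    · simp [← h0]
    refine mul_nonneg hpos.le (sub_nonneg.2 ?_)
    rcases (hζ x' h).eq_or_lt with h0 | hsel
    · exact h0 ▸ hp.condSel_nonneg hζ h x'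
    · exact (hF.eq_condSel_of_pos hp hζ hpos hsel).le
  have hsum : ∑ x' ∈ univ.filter (fun x' => applyMask x' h = applyMask x h),
      pX p x' * (condSel p ζ h x - ζ x' h) = 0 := by
    simp only [mul_sub, Finset.sum_sub_distrib, ← Finset.sum_mul]
    change pIn p h x * (pInSel p ζ h x / pIn p h x) - pInSel p ζ h x = 0
    rw [mul_div_cancel₀ _ (hp.pIn_pos h hx).ne', sub_self]
  have hzero := (Finset.sum_eq_zero_iff_of_nonneg hnonneg).1 hsum x (by simp)
  linarith [(mul_eq_zero.1 hzero).resolve_left hx.ne']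

theorem pInSel_eq_pIn_mul (hp : IsDist p) {h : Mask d} {x : ∀ i, V i}
    (hconst : ∀ x', 0 < pX p x' → applyMask x' h = applyMask x h → ζ x' h = ζ x h) :
    pInSel p ζ h x = pIn p h x * ζ x h := by
  rw [pInSel, pIn, Finset.sum_mul]
  refine Finset.sum_congr rfl fun x' hx' => ?_
  rcases (hp.pX_nonneg x').eq_or_lt with h0 | hpos
  · simp [← h0]
  · rw [hconst x' hpos (mem_filter.1 hx').2]

theorem pInYSel_eq_pInY_mul (hp : IsDist p) {h : Mask d} {x : ∀ i, V i} (y : Y)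
    (hconst : ∀ x', 0 < pX p x' → applyMask x' h = applyMask x h → ζ x' h = ζ x h) :
    pInYSel p ζ h x y = pInY p h x y * ζ x h := by
  rw [pInYSel, pInY, Finset.sum_mul]
  refine Finset.sum_congr rfl fun x' hx' => ?_
  rcases (hp.1 x' y).eq_or_lt with h0 | hpos
  · simp [← h0]
  · rw [hconst x' (hpos.trans_le (hp.le_pX x' y)) (mem_filter.1 hx').2]

end

/-- functional characterization of no leakage: `ζ` has no leakage
if and only if the probability of each mask depends only on the values of the
features selected by that mask. -/
theorem noLeakage_iff_mask_prob_depends_only_on_selected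
    (hp : IsDist p) (hζ : IsSelector p ζ) :
    (NoLabelLeakage p ζ ∧ NoFeatureLeakage p ζ) ↔
      ∀ (h : Mask d) (x x' : ∀ i, V i), 0 < pX p x → 0 < pX p x' →
        applyMask x h = applyMask x' h → ζ x h = ζ x' h := by
  constructor
  · rintro ⟨-, hF⟩ h x x' hx hx' hxx'
    rw [hF.eq_condSel hp hζ.1 h hx, hF.eq_condSel hp hζ.1 h hx', condSel_congr hxx']
  · intro H
    refine ⟨fun h x y ⟨hx, hxh, _⟩ => ?_, fun h x _ ⟨hx, hxh, _⟩ => ?_⟩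
    · rw [condLabel, condLabelSel,
        pInYSel_eq_pInY_mul hp y fun x' hx' hxx' => H h x' x hx' hx hxx',
        pInSel_eq_pIn_mul hp fun x' hx' hxx' => H h x' x hx' hx hxx',
        mul_div_mul_right _ _ hxh.ne']
    · rw [condFeat, condFeatSel, pInSel_eq_pIn_mul hp fun x' hx' hxx' => H h x' x hx' hx hxx',
        mul_div_mul_right _ _ hxh.ne']

end Leakage

end
end

section
/- A concrete selector with leakage achieving perfect prediction: let d = 2, let x be uniform on {0,1}^2, let y = x[1] + x[2], and let ζ be the deterministic selector with ζ((1,0) | (1,1)) = 1, ζ((0,1) | (0,1)) = 1, ζ((0,1) | (1,0)) = 1, and ζ((0,0) | (0,0)) = 1. Then: (a) ζ has label leakage; (b) ζ has feature leakage; (c) the map x⊙h ↦ y is well-defined on the support of the joint distribution, i.e., there exists a predictor f on masked vectors with f(x⊙h) = y with probability 1 (perfect prediction); and (d) the expected fraction of selected features is 3/8. -/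
open Finset

noncomputable section

variable {d : ℕ} {V : Fin d → Type*} {Y : Type*}

/-- The mask selected for each instance: `(1,0)` for `x = (1,1)`, `(0,1)` for
`x = (0,1)` and `x = (1,0)`, and `(0,0)` for `x = (0,0)`. -/
def tgtEx (x : Fin 2 → Bool) : Mask 2 :=
  if x 0 && x 1 then (fun j => decide (j = (0 : Fin 2)))
  else if x 0 || x 1 then (fun j => decide (j = (1 : Fin 2)))
  else (fun _ => false)

/-- The deterministic selector of the example. -/
def zetaEx (x : Fin 2 → Bool) (h : Mask 2) : ℝ := if h = tgtEx x then 1 else 0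

/-- The joint distribution: `x` uniform on `{0,1}²` and `y = x[1] + x[2]`. -/
def pEx (x : Fin 2 → Bool) (y : Fin 3) : ℝ :=
  if (y : ℕ) = (if x 0 = true then 1 else 0) + (if x 1 = true then 1 else 0)
  then 1 / 4 else 0

theorem sum_fin_two_bool (g : (Fin 2 → Bool) → ℝ) :
    ∑ x, g x = g ![true, true] + g ![true, false] + (g ![false, true] + g ![false, false]) := by
  rw [← (finTwoArrowEquiv Bool).symm.sum_comp g, Fintype.sum_prod_type]
  simp [finTwoArrowEquiv]

theorem pX_pEx (x : Fin 2 → Bool) : pX pEx x = 1 / 4 := by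
  unfold pX pEx
  cases x 0 <;> cases x 1 <;> simp [Fin.sum_univ_three]

theorem mask_eq_iff (h k : Mask 2) : h = k ↔ h 0 = k 0 ∧ h 1 = k 1 := by
  simp [funext_iff, Fin.forall_fin_two]

theorem inOmega_all_ones : InOmega pEx zetaEx ![true, false] ![true, true] 2 := by
  refine ⟨by simp [pX_pEx], by simp [zetaEx, tgtEx, mask_eq_iff], ?_⟩
  simp [pInY, sum_filter, sum_fin_two_bool, applyMask, pEx, funext_iff, Fin.forall_fin_two]

theorem pIn_all_ones : pIn pEx ![true, false] ![true, true] = 1 / 2 := by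
  simp only [pIn, sum_filter, sum_fin_two_bool, pX_pEx]
  norm_num [applyMask, funext_iff, Fin.forall_fin_two]

theorem pInY_all_ones : pInY pEx ![true, false] ![true, true] 2 = 1 / 4 := by
  simp [pInY, sum_filter, sum_fin_two_bool, applyMask, pEx, funext_iff, Fin.forall_fin_two]

theorem pInSel_all_ones : pInSel pEx zetaEx ![true, false] ![true, true] = 1 / 4 := by
  simp [pInSel, sum_filter, sum_fin_two_bool, applyMask, pX_pEx, zetaEx, tgtEx, funext_iff,
    Fin.forall_fin_two]

theorem pInYSel_all_ones : pInYSel pEx zetaEx ![true, false] ![true, true] 2 = 1 / 4 := by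
  simp [pInYSel, sum_filter, sum_fin_two_bool, applyMask, pEx, zetaEx, tgtEx, funext_iff,
    Fin.forall_fin_two]

/-- The label predicted from a masked vector: it depends only on which feature is visible. -/
def predictEx (z : ∀ _ : Fin 2, Option Bool) : Fin 3 :=
  if (z 0).isSome then 2 else if (z 1).isSome then 1 else 0

theorem predictEx_applyMask (x : Fin 2 → Bool) (y : Fin 3) (h : Mask 2)
    (hpos : 0 < pEx x y * zetaEx x h) : predictEx (applyMask x h) = y := by
  have hy : pEx x y ≠ 0 := left_ne_zero_of_mul hpos.ne'
  have hh : h = tgtEx x := by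
    by_contra hne
    simp [zetaEx, hne] at hpos
  subst hh
  revert hy
  cases h0 : x 0 <;> cases h1 : x 1 <;> fin_cases y <;>
    simp [pEx, predictEx, applyMask, tgtEx, h0, h1]

theorem sum_label_mask (x : Fin 2 → Bool) :
    ∑ y : Fin 3, ∑ h : Mask 2, pEx x y * zetaEx x h * (maskSize h / 2) =
      maskSize (tgtEx x) / 8 := by
  have hmask (y : Fin 3) : ∑ h : Mask 2, pEx x y * zetaEx x h * (maskSize h / 2) =
      pEx x y * (maskSize (tgtEx x) / 2) := by
    simp [zetaEx]
  simp_rw [hmask, ← sum_mul]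
  rw [show ∑ y, pEx x y = 1 / 4 from pX_pEx x]
  ring

theorem maskSize_eq (h : Mask 2) :
    maskSize h = (if h 0 = true then 1 else 0) + (if h 1 = true then 1 else 0) := by
  simp [maskSize, card_filter, Fin.sum_univ_two, -sum_boole]

/-- a concrete selector with leakage achieving perfect
prediction: (a) it has label leakage; (b) it has feature leakage; (c) there is
a predictor on masked vectors that predicts the label perfectly on the support
of the joint distribution; and (d) the expected fraction of selected features
is `3/8`. -/
theorem concrete_selector_with_leakage_perfect_prediction :
    (¬ NoLabelLeakage pEx zetaEx) ∧
    (¬ NoFeatureLeakage pEx zetaEx) ∧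
    (∃ f : (∀ _ : Fin 2, Option Bool) → Fin 3,
      ∀ (x : Fin 2 → Bool) (y : Fin 3) (h : Mask 2),
        0 < pEx x y * zetaEx x h → f (applyMask x h) = y) ∧
    (∑ x : Fin 2 → Bool, ∑ y : Fin 3, ∑ h : Mask 2,
        pEx x y * zetaEx x h * (maskSize h / 2)) = 3 / 8 := by
  refine ⟨fun H => ?_, fun H => ?_, ⟨predictEx, predictEx_applyMask⟩, ?_⟩
  · have := H _ _ _ inOmega_all_ones
    norm_num [condLabel, condLabelSel, pIn_all_ones, pInY_all_ones, pInSel_all_ones,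
      pInYSel_all_ones] at this
  · have := H _ _ _ inOmega_all_ones
    norm_num [condFeat, condFeatSel, pIn_all_ones, pInSel_all_ones, pX_pEx, zetaEx, tgtEx,
      mask_eq_iff] at this
  · simp_rw [sum_label_mask, maskSize_eq]
    norm_num [sum_fin_two_bool, tgtEx]

end
end

section
/- Impossibility of perfect two-feature prediction without leakage on the toy problem: let d = 10, let x be uniform on {0,1}^{10}, and let y(x) = (Σ_{i=1}^{5} x[2i−1]·x[2i])². Then: (a) for every mask h ∈ {0,1}^{10} with at most 2 ones and every x ∈ {0,1}^{10}, there exists x' ∈ {0,1}^{10} with x'⊙h = x⊙h and y(x') ≠ y(x); and consequently (b) for every feature selector ζ without leakage such that ζ(h|x) > 0 implies h has at most 2 ones, and every predictor f mapping masked vectors to ℝ, the mean squared error E[(f(x⊙h) − y)²] under the joint distribution of (x, y, h) is strictly positive. -/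
open Finset

noncomputable section

variable {d : ℕ} {V : Fin d → Type*} {Y : Type*}

/-- The toy label `y(x) = (Σ_{i=1}^{5} x[2i−1]·x[2i])²`. -/
def yToy (x : Fin 10 → Bool) : ℕ :=
  (∑ i : Fin 5,
      if x ⟨2 * i.val, by have := i.isLt; omega⟩ &&
          x ⟨2 * i.val + 1, by have := i.isLt; omega⟩ then 1 else 0) ^ 2

/-- The joint distribution of the toy problem: `x` uniform on `{0,1}^{10}` and
`y = yToy x` (labels live in `Fin 26` since `yToy x ≤ 25`). -/
def pToy (x : Fin 10 → Bool) (y : Fin 26) : ℝ :=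
  if (y : ℕ) = yToy x then 1 / 1024 else 0

/-- The toy label is the square of a sum of five bits. -/
theorem yToy_lt (x : Fin 10 → Bool) : yToy x < 26 := by
  have h : (∑ i : Fin 5,
      if x ⟨2 * i.val, by have := i.isLt; omega⟩ &&
          x ⟨2 * i.val + 1, by have := i.isLt; omega⟩ then 1 else 0) ≤ ∑ _i : Fin 5, 1 :=
    Finset.sum_le_sum fun i _ => by split_ifs <;> simp
  simp only [sum_const, card_univ, Fintype.card_fin, smul_eq_mul, mul_one] at h
  have := Nat.pow_le_pow_left h 2
  unfold yToy
  omega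

/-- The toy label, as an element of the label set `Fin 26`. -/
def yToyFin (x : Fin 10 → Bool) : Fin 26 := ⟨yToy x, yToy_lt x⟩

theorem pToy_nonneg (x : Fin 10 → Bool) (y : Fin 26) : 0 ≤ pToy x y := by
  unfold pToy
  split_ifs <;> norm_num

theorem pToy_yToyFin_pos (x : Fin 10 → Bool) : 0 < pToy x (yToyFin x) := by
  simp [pToy, yToyFin]

theorem pX_pToy_pos (x : Fin 10 → Bool) : 0 < pX pToy x :=
  Finset.sum_pos' (fun y _ => pToy_nonneg x y) ⟨yToyFin x, mem_univ _, pToy_yToyFin_pos x⟩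

/-- A mask with fewer than five ones leaves one of the five pairs unselected. -/
theorem exists_unselected_pair (h : Mask 10)
    (hh : (univ.filter fun i => h i = true).card < 5) :
    ∃ k : Fin 5, ∀ i : Fin 10, i.val / 2 = k.val → h i = false := by
  by_contra! hc
  refine absurd hh (not_lt.mpr ?_)
  have hsurj : (univ : Finset (Fin 5)) ⊆
      (univ.filter fun i => h i = true).image
        fun i : Fin 10 => (⟨i.val / 2, by have := i.isLt; omega⟩ : Fin 5) := by
    intro k _
    obtain ⟨i, hik, hi⟩ := hc k
    exact mem_image.mpr ⟨i, by simpa using hi, Fin.ext hik⟩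
  simpa using (card_le_card hsurj).trans card_image_le

/-- Sums of families that differ at exactly one index are distinct. -/
theorem sum_ne_sum_of_ne_at {ι : Type*} [Fintype ι] [DecidableEq ι] {f g : ι → ℕ} (k : ι)
    (hk : f k ≠ g k) (hrest : ∀ i, i ≠ k → f i = g i) : ∑ i, f i ≠ ∑ i, g i := by
  rw [← Finset.add_sum_erase _ f (mem_univ k), ← Finset.add_sum_erase _ g (mem_univ k),
    Finset.sum_congr rfl fun i hi => hrest i (mem_erase.mp hi).1]
  simpa using hk

/-- Overwriting a pair by the negation of its product changes the toy label. -/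
theorem yToy_overwrite_ne (x : Fin 10 → Bool) (k : Fin 5) :
    yToy (fun i => if i.val / 2 = k.val then
      !(x ⟨2 * k.val, by have := k.isLt; omega⟩ &&
        x ⟨2 * k.val + 1, by have := k.isLt; omega⟩) else x i) ≠ yToy x := by
  unfold yToy
  rw [Ne, Nat.pow_left_inj two_ne_zero]
  refine sum_ne_sum_of_ne_at k ?_ fun i hi => ?_
  · have h₀ : 2 * k.val / 2 = k.val := by omega
    have h₁ : (2 * k.val + 1) / 2 = k.val := by omega
    simp only [h₀, h₁, if_true, Bool.and_self]
    cases (x ⟨2 * k.val, by have := k.isLt; omega⟩ &&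
      x ⟨2 * k.val + 1, by have := k.isLt; omega⟩) <;> simp
  · have hik : i.val ≠ k.val := fun e => hi (Fin.ext e)
    have h₀ : 2 * i.val / 2 ≠ k.val := by omega
    have h₁ : (2 * i.val + 1) / 2 ≠ k.val := by omega
    simp only [h₀, h₁, if_false]

theorem exists_applyMask_eq_yToy_ne (h : Mask 10)
    (hh : (univ.filter fun i => h i = true).card < 5) (x : Fin 10 → Bool) :
    ∃ x' : Fin 10 → Bool, applyMask x' h = applyMask x h ∧ yToy x' ≠ yToy x := by
  obtain ⟨k, hk⟩ := exists_unselected_pair h hh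
  refine ⟨_, ?_, yToy_overwrite_ne x k⟩
  funext i
  by_cases hi : i.val / 2 = k.val
  · simp [applyMask, hk i hi]
  · simp [applyMask, hi]

/-- Without label leakage, a label that occurs together with the selected features
also occurs together with the selection. -/
theorem NoLabelLeakage.exists_selected {d : ℕ} {V : Fin d → Type*} {Y : Type*}
    [∀ i, Fintype (V i)] [∀ i, DecidableEq (V i)] [Fintype Y]
    {p : (∀ i, V i) → Y → ℝ} {ζ : (∀ i, V i) → Mask d → ℝ}
    (hp : ∀ x y, 0 ≤ p x y) (hleak : NoLabelLeakage p ζ)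
    {h : Mask d} {x : ∀ i, V i} {y : Y} (hΩ : InOmega p ζ h x y) :
    ∃ x', applyMask x' h = applyMask x h ∧ p x' y * ζ x' h ≠ 0 := by
  have hpX : ∀ x', 0 ≤ pX p x' := fun x' => Finset.sum_nonneg fun y _ => hp x' y
  have hIn : 0 < pIn p h x :=
    Finset.sum_pos' (fun x' _ => hpX x') ⟨x, by simp, hΩ.1⟩
  have hcond : 0 < condLabel p h x y := div_pos hΩ.2.2 hIn
  rw [hleak h x y hΩ, condLabelSel] at hcond
  have hSel : pInYSel p ζ h x y ≠ 0 := fun h0 => by simp [h0] at hcond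
  obtain ⟨x', hx', hne⟩ := Finset.exists_ne_zero_of_sum_ne_zero hSel
  exact ⟨x', (mem_filter.mp hx').2, hne⟩

/-- impossibility of perfect two-feature prediction without
leakage on the toy problem: (a) for every mask with at most 2 ones and every
`x` there is an `x'` agreeing with `x` on the selected features but with a
different label; consequently (b) every leakage-free feature selector that
only uses masks with at most 2 ones has strictly positive mean squared error
for every predictor `f`. -/
theorem toy_two_features_impossible_without_leakage :
    (∀ h : Mask 10, (univ.filter fun i => h i = true).card ≤ 2 →
      ∀ x : Fin 10 → Bool, ∃ x' : Fin 10 → Bool,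
        applyMask x' h = applyMask x h ∧ yToy x' ≠ yToy x) ∧
    (∀ ζ : (Fin 10 → Bool) → Mask 10 → ℝ,
      IsSelector pToy ζ →
      NoLabelLeakage pToy ζ → NoFeatureLeakage pToy ζ →
      (∀ (x : Fin 10 → Bool) (h : Mask 10), 0 < pX pToy x → 0 < ζ x h →
        (univ.filter fun i => h i = true).card ≤ 2) →
      ∀ f : (∀ _ : Fin 10, Option Bool) → ℝ,
        0 < ∑ x : Fin 10 → Bool, ∑ y : Fin 26, ∑ h : Mask 10,
          pToy x y * ζ x h * (f (applyMask x h) - ((y : ℕ) : ℝ)) ^ 2) := by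
  refine ⟨fun h hh x => exists_applyMask_eq_yToy_ne h (by omega) x, ?_⟩
  intro ζ hζ hleak _ hsize f
  have hterm : ∀ x y h,
      0 ≤ pToy x y * ζ x h * (f (applyMask x h) - ((y : ℕ) : ℝ)) ^ 2 := fun x y h =>
    mul_nonneg (mul_nonneg (pToy_nonneg x y) (hζ.1 x h)) (sq_nonneg _)
  by_contra hneg
  have hzero : ∀ x y h, pToy x y * ζ x h ≠ 0 → f (applyMask x h) = ((y : ℕ) : ℝ) := by
    intro x y h hne
    by_contra hf
    refine hneg (Finset.sum_pos' (fun x _ => Finset.sum_nonneg fun y _ =>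
      Finset.sum_nonneg fun h _ => hterm x y h) ⟨x, mem_univ _, Finset.sum_pos'
        (fun y _ => Finset.sum_nonneg fun h _ => hterm x y h) ⟨y, mem_univ _,
          Finset.sum_pos' (fun h _ => hterm x y h) ⟨h, mem_univ _, ?_⟩⟩⟩)
    exact lt_of_le_of_ne (hterm x y h)
      (mul_ne_zero hne (pow_ne_zero 2 (sub_ne_zero.mpr hf))).symm
  let x : Fin 10 → Bool := fun _ => false
  obtain ⟨h, -, hh⟩ := Finset.exists_ne_zero_of_sum_ne_zero
    (ne_of_eq_of_ne (hζ.2 x (pX_pToy_pos x)) one_ne_zero)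
  have hpos : 0 < ζ x h := lt_of_le_of_ne (hζ.1 x h) hh.symm
  have hcard := hsize x h (pX_pToy_pos x) hpos
  obtain ⟨x', hmask, hy⟩ := exists_applyMask_eq_yToy_ne h (by omega) x
  have hΩ : InOmega pToy ζ h x (yToyFin x') :=
    ⟨pX_pToy_pos x, hpos, Finset.sum_pos' (fun z _ => pToy_nonneg z _)
      ⟨x', by simpa using hmask, pToy_yToyFin_pos x'⟩⟩
  obtain ⟨z, hz, hne⟩ := hleak.exists_selected pToy_nonneg hΩ
  have e₁ := hzero z _ h hne
  have e₂ := hzero x (yToyFin x) h (mul_ne_zero (pToy_yToyFin_pos x).ne' hh)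
  rw [hz, e₂] at e₁
  exact hy (Nat.cast_injective (R := ℝ) e₁).symm

end
end

section
/- Reformulation of the feature-selection objective over unique masked values: let ζ be a feature selector satisfying ζ(h|x) = ζ(h|x') whenever p(x) > 0, p(x') > 0 and x⊙h = x'⊙h, and write ζ(h | m) for this common value where m = x⊙h. Then for any predictor f on masked vectors, loss function L, and λ ≥ 0: Σ_{x,y} p(x,y) Σ_{h} ζ(h|x) · ( L(f(x⊙h), y) + λ·‖h‖₀ ) = Σ_{m} ζ(h_m | m) · Σ_{x' : x'⊙h_m = m, p(x')>0} p(x') · ( λ·‖h_m‖₀ + Σ_{y} p(y | x') · L(f(m), y) ), where the outer sum on the right ranges over all distinct masked vectors m = x⊙h arising from some x with p(x) > 0 and some mask h, h_m denotes the mask determined by m (the set of unmasked positions of m), and ‖h‖₀ is the number of ones in h. -/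
open Finset

noncomputable section

variable {d : ℕ} {V : Fin d → Type*} {Y : Type*}

section Leakage

variable [∀ i, Fintype (V i)] [∀ i, DecidableEq (V i)] [∀ i, Nonempty (V i)]
  [Fintype Y] [DecidableEq Y]

variable (p : (∀ i, V i) → Y → ℝ) (ζ : (∀ i, V i) → Mask d → ℝ)

/-- The mask `h_m` determined by a masked vector `m`: its set of unmasked
positions. -/
def maskOf {d : ℕ} {V : Fin d → Type*} (m : ∀ i, Option (V i)) : Mask d :=
  fun i => (m i).isSome

theorem maskOf_applyMask (x : ∀ i, V i) (h : Mask d) : maskOf (applyMask x h) = h := by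
  funext i
  cases hi : h i <;> simp [maskOf, applyMask, hi]

/-- Summing over masks `h` is summing over the masked vectors `x ⊙ h`. -/
theorem sum_mask_eq_sum_masked {M : Type*} [AddCommMonoid M] (x : ∀ i, V i)
    (s : Finset (∀ i, Option (V i))) (hs : ∀ h, applyMask x h ∈ s)
    (g : (∀ i, Option (V i)) → M) :
    ∑ h : Mask d, g (applyMask x h)
      = ∑ m ∈ s.filter (fun m => applyMask x (maskOf m) = m), g m := by
  refine Finset.sum_bij' (fun h _ => applyMask x h) (fun m _ => maskOf m) ?_ ?_ ?_ ?_ ?_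
  · intro h _
    simp [hs h, maskOf_applyMask]
  · simp
  · intro h _
    exact maskOf_applyMask x h
  · intro m hm
    exact (Finset.mem_filter.mp hm).2
  · simp

theorem prob_eq_zero_of_pX_eq_zero (hp : ∀ x y, 0 ≤ p x y) {x : ∀ i, V i} (hx : pX p x = 0)
    (y : Y) : p x y = 0 :=
  (Finset.sum_eq_zero_iff_of_nonneg fun y _ => hp x y).mp hx y (mem_univ y)

/-- Conditioning on `x` pulls the factor `p(x)` out of an expected regularized loss. -/
theorem sum_prob_mul_add_const {x : ∀ i, V i} (hx : pX p x ≠ 0) (l : Y → ℝ) (c : ℝ) :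
    ∑ y, p x y * (l y + c) = pX p x * (c + ∑ y, p x y / pX p x * l y) := by
  simp_rw [mul_add, Finset.sum_add_distrib, ← Finset.sum_mul, Finset.mul_sum]
  rw [add_comm]
  congr 1
  refine Finset.sum_congr rfl fun y _ => ?_
  field_simp

/-- reformulation of the feature-selection objective over unique
masked values: if `ζ(h|x)` only depends on `x⊙h` (with `Z` giving this common
value `ζ(h|m)` for `m = x⊙h`), then the objective
`Σ_{x,y} p(x,y) Σ_h ζ(h|x)·(L(f(x⊙h),y) + λ‖h‖₀)` equals the sum over all
distinct masked vectors `m` arising from some positive-probability instance of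
`ζ(h_m|m) · Σ_{x' : x'⊙h_m = m, p(x')>0} p(x')·(λ‖h_m‖₀ + Σ_y p(y|x')·L(f(m),y))`. -/
theorem objective_reformulation_over_unique_masked_values
    (hp : IsDist p)
    (hconst : ∀ (h : Mask d) (x x' : ∀ i, V i), 0 < pX p x → 0 < pX p x' →
      applyMask x h = applyMask x' h → ζ x h = ζ x' h)
    {α : Type*} (f : (∀ i, Option (V i)) → α) (L : α → Y → ℝ)
    (lam : ℝ) (hlam : 0 ≤ lam)
    (Z : (∀ i, Option (V i)) → ℝ)
    (hZ : ∀ (x : ∀ i, V i) (h : Mask d), 0 < pX p x → Z (applyMask x h) = ζ x h) :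
    ∑ x : ∀ i, V i, ∑ y : Y, ∑ h : Mask d,
        p x y * ζ x h * (L (f (applyMask x h)) y + lam * maskSize h)
      = ∑ m ∈ univ.filter (fun m : ∀ i, Option (V i) =>
            ∃ (x : ∀ i, V i) (h : Mask d), 0 < pX p x ∧ applyMask x h = m),
          Z m *
            ∑ x' ∈ univ.filter (fun x' : ∀ i, V i =>
                applyMask x' (maskOf m) = m ∧ 0 < pX p x'),
              pX p x' *
                (lam * maskSize (maskOf m) +
                  ∑ y : Y, (p x' y / pX p x') * L (f m) y) := by
  have hnn : ∀ x, 0 ≤ pX p x := fun x => Finset.sum_nonneg fun y _ => hp.1 x y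
  simp_rw [Finset.mul_sum (univ.filter _)]
  rw [Finset.sum_comm' (t' := univ.filter fun x => 0 < pX p x)
    (s' := fun x => (univ.filter (fun m : ∀ i, Option (V i) =>
      ∃ (x : ∀ i, V i) (h : Mask d), 0 < pX p x ∧ applyMask x h = m)).filter
        fun m => applyMask x (maskOf m) = m)
    (by intro m x; simp only [mem_filter, mem_univ, true_and]; tauto)]
  rw [Finset.sum_filter]
  refine Finset.sum_congr rfl fun x _ => ?_
  split_ifs with hx
  · rw [← sum_mask_eq_sum_masked x _
      (fun h => Finset.mem_filter.mpr ⟨mem_univ _, x, h, hx, rfl⟩), Finset.sum_comm]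
    refine Finset.sum_congr rfl fun h _ => ?_
    rw [hZ x h hx, maskOf_applyMask, ← sum_prob_mul_add_const p hx.ne', Finset.mul_sum]
    exact Finset.sum_congr rfl fun y _ => by ring
  · have hx0 : pX p x = 0 := le_antisymm (not_lt.mp hx) (hnn x)
    simp [prob_eq_zero_of_pX_eq_zero p hp.1 hx0]

end Leakage

end
end
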